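/- arXiv:2211.10788 — 2 statements merged into one kernel-verified Lean document; each statement's English description precedes it below -/
import Mathlib

section
/- Let p be a prime and let t ≥ 1 be an integer. (1) If p ≡ ±2 (mod 5) and 2t+1 ≤ p, then F(p-(2t+1)) ≡ F(2(t+1)) (mod p). (2) If p ≡ ±1 (mod 5) and 2t ≤ p, then F(p-2t) ≡ F(2t-1) (mod p). -/
theorem fib_docagne (n j : ℕ) :
    (Nat.fib (n + j) : ℤ) * Nat.fib (j + 1) - Nat.fib (n + j + 1) * Nat.fib j =
      (-1) ^ j * Nat.fib n := by
  induction j with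
  | zero => simp
  | succ j ih =>
    have h₁ : Nat.fib (n + (j + 1) + 1) = Nat.fib (n + j) + Nat.fib (n + j + 1) :=
      Nat.fib_add_two
    have h₂ : Nat.fib (j + 1 + 1) = Nat.fib j + Nat.fib (j + 1) := Nat.fib_add_two
    rw [h₁, h₂, ← add_assoc n j 1, pow_succ]
    push_cast
    linear_combination -ih

theorem pow_succ_eq_fib_mul_add_fib {R : Type*} [CommRing R] {x : R} (hx : x ^ 2 = x + 1)
    (n : ℕ) : x ^ (n + 1) = Nat.fib (n + 1) * x + Nat.fib n := by
  induction n with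
  | zero => simp
  | succ n ih =>
    rw [pow_succ, ih, Nat.fib_add_two]
    push_cast
    linear_combination (Nat.fib (n + 1) : R) * hx

theorem two_mul_pow_char_sub_one {K : Type*} [Field K] {p : ℕ} [Fact p.Prime] [CharP K p]
    (hp : p ≠ 2) {x : K} (hx : x ^ 2 = x + 1) :
    2 * x ^ p - 1 = (5 : K) ^ (p / 2) * (2 * x - 1) := by
  have hsq : (2 * x - 1) ^ 2 = 5 := by linear_combination 4 * hx
  have htwo : (2 : K) ^ p = 2 := by
    have h := map_ofNat (frobenius K p) 2
    rwa [frobenius_def] at h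
  have hodd : 2 * (p / 2) + 1 = p :=
    Nat.two_mul_div_two_add_one_of_odd ((Fact.out : p.Prime).odd_of_ne_two hp)
  calc 2 * x ^ p - 1 = (2 * x - 1) ^ p := by
        rw [sub_pow_char, mul_pow, htwo, one_pow]
    _ = (2 * x - 1) ^ (2 * (p / 2) + 1) := by rw [hodd]
    _ = (5 : K) ^ (p / 2) * (2 * x - 1) := by rw [pow_succ, pow_mul, hsq]

theorem fib_prime_of_sq_eq_five {K : Type*} [Field K] {p : ℕ} [Fact p.Prime] [CharP K p]
    (hp2 : p ≠ 2) (hp5 : p ≠ 5) {s : K} (hs : s ^ 2 = 5) :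
    (Nat.fib p : K) = 5 ^ (p / 2) ∧ (Nat.fib p : K) + 2 * Nat.fib (p - 1) = 1 := by
  have hp : p.Prime := Fact.out
  have h2 : (2 : K) ≠ 0 := by
    have h := (CharP.cast_eq_zero_iff K p 2).not.2 fun hd =>
      hp2 ((Nat.prime_dvd_prime_iff_eq hp Nat.prime_two).1 hd)
    exact_mod_cast h
  have h5 : (5 : K) ≠ 0 := by
    have h := (CharP.cast_eq_zero_iff K p 5).not.2 fun hd =>
      hp5 ((Nat.prime_dvd_prime_iff_eq hp Nat.prime_five).1 hd)
    exact_mod_cast h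
  have hs0 : s ≠ 0 := by
    rintro rfl
    exact h5 (by simpa using hs.symm)
  have key (r : K) (hr : r ^ 2 = 5) :
      Nat.fib p * (1 + r) + 2 * Nat.fib (p - 1) - 1 = (5 : K) ^ (p / 2) * r := by
    have hx : ((1 + r) / 2) ^ 2 = (1 + r) / 2 + 1 := by
      field_simp
      linear_combination hr
    have hF := pow_succ_eq_fib_mul_add_fib hx (p - 1)
    rw [Nat.sub_add_cancel hp.one_le] at hF
    have hpow := two_mul_pow_char_sub_one hp2 hx
    rw [hF] at hpow
    have hdiv : 2 * ((1 + r) / 2) = 1 + r := mul_div_cancel₀ _ h2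
    linear_combination hpow + ((5 : K) ^ (p / 2) - Nat.fib p) * hdiv
  have hpos := key s hs
  have hneg := key (-s) (by rw [neg_sq, hs])
  exact ⟨mul_left_cancel₀ (mul_ne_zero h2 hs0) (by linear_combination hpos - hneg),
    mul_left_cancel₀ h2 (by linear_combination hpos + hneg)⟩

theorem fib_prime_zmod {p : ℕ} [Fact p.Prime] (hp2 : p ≠ 2) (hp5 : p ≠ 5) :
    (Nat.fib p : ZMod p) = 5 ^ (p / 2) ∧
      (Nat.fib p : ZMod p) + 2 * Nat.fib (p - 1) = 1 := by
  obtain ⟨s, hs⟩ := IsAlgClosed.exists_pow_nat_eq (5 : AlgebraicClosure (ZMod p)) two_pos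
  have : CharP (AlgebraicClosure (ZMod p)) p :=
    charP_of_injective_algebraMap (algebraMap (ZMod p) _).injective p
  obtain ⟨hfib, hsum⟩ := fib_prime_of_sq_eq_five hp2 hp5 hs
  constructor <;> apply (algebraMap (ZMod p) (AlgebraicClosure (ZMod p))).injective
  · rw [map_natCast, map_pow, map_ofNat, hfib]
  · rw [map_add, map_mul, map_natCast, map_natCast, map_ofNat, map_one, hsum]

theorem legendreSym_five {p : ℕ} [Fact p.Prime] [Fact (Nat.Prime 5)] (hp2 : p ≠ 2) :
    legendreSym p 5 = legendreSym 5 (p % 5 : ℕ) := by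
  have hrec := legendreSym.quadratic_reciprocity_one_mod_four (p := 5) (q := p)
    (by norm_num) hp2
  rw [legendreSym.mod 5] at hrec
  exact_mod_cast hrec

theorem five_pow_half_zmod {p : ℕ} [Fact p.Prime] [Fact (Nat.Prime 5)] (hp2 : p ≠ 2) :
    (5 : ZMod p) ^ (p / 2) = (legendreSym 5 (p % 5 : ℕ) : ZMod p) := by
  rw [← legendreSym_five hp2, legendreSym.eq_pow]
  norm_cast

theorem fib_mod_p_shift (p t : ℕ) (hp : p.Prime) (ht : 1 ≤ t) :
    ((p % 5 = 2 ∨ p % 5 = 3) → 2 * t + 1 ≤ p →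
      Nat.fib (p - (2 * t + 1)) ≡ Nat.fib (2 * (t + 1)) [MOD p]) ∧
    ((p % 5 = 1 ∨ p % 5 = 4) → 2 * t ≤ p →
      Nat.fib (p - 2 * t) ≡ Nat.fib (2 * t - 1) [MOD p]) := by
  have : Fact p.Prime := ⟨hp⟩
  have : Fact (Nat.Prime 5) := ⟨Nat.prime_five⟩
  have cancel_two (hp2 : p ≠ 2) {a b : ZMod p} (h : 2 * a = 2 * b) : a = b := by
    have : Fact (2 < p) := ⟨lt_of_le_of_ne hp.two_le hp2.symm⟩
    exact mul_left_cancel₀ (ZMod.natCast_eq_zero_iff 2 p |>.not.2 fun hd =>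
      hp2 ((Nat.prime_dvd_prime_iff_eq hp Nat.prime_two).1 hd)) (by exact_mod_cast h)
  constructor
  · intro hmod hle
    have hp2 : p ≠ 2 := by omega
    obtain ⟨hfib, hsum⟩ := fib_prime_zmod hp2 (by omega)
    have hleg : legendreSym 5 (p % 5 : ℕ) = -1 := by
      rcases hmod with h | h <;> rw [h] <;> clear * - <;> decide +revert
    rw [five_pow_half_zmod hp2, hleg] at hfib
    push_cast at hfib
    have hpred : (Nat.fib (p - 1) : ZMod p) = 1 :=
      cancel_two hp2 (by linear_combination hsum - hfib)
    have hsucc : (Nat.fib (p + 1) : ZMod p) = 0 := by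
      rw [Nat.fib_add_one hp.ne_zero]
      push_cast
      linear_combination hpred + hfib
    have hsucc₂ : (Nat.fib (p + 1 + 1) : ZMod p) = -1 := by
      rw [Nat.fib_add_two]
      push_cast
      linear_combination hfib + hsucc
    have hd := congrArg (Int.cast : ℤ → ZMod p)
      (fib_docagne (p - (2 * t + 1)) (2 * (t + 1)))
    rw [show p - (2 * t + 1) + 2 * (t + 1) = p + 1 by omega, pow_mul] at hd
    push_cast at hd
    rw [hsucc, hsucc₂] at hd
    rw [← ZMod.natCast_eq_natCast_iff]
    simpa using hd.symm
  · intro hmod hle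
    have hp2 : p ≠ 2 := by omega
    obtain ⟨hfib, hsum⟩ := fib_prime_zmod hp2 (by omega)
    have hleg : legendreSym 5 (p % 5 : ℕ) = 1 := by
      rcases hmod with h | h <;> rw [h] <;> clear * - <;> decide +revert
    rw [five_pow_half_zmod hp2, hleg] at hfib
    push_cast at hfib
    have hpred : (Nat.fib (p - 1) : ZMod p) = 0 :=
      cancel_two hp2 (by linear_combination hsum - hfib)
    have hd := congrArg (Int.cast : ℤ → ZMod p) (fib_docagne (p - 2 * t) (2 * t - 1))
    have hodd : Odd (2 * t - 1) := ⟨t - 1, by omega⟩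
    rw [show p - 2 * t + (2 * t - 1) = p - 1 by omega, Nat.sub_add_cancel hp.one_le,
      hodd.neg_one_pow] at hd
    push_cast at hd
    rw [hpred, hfib] at hd
    rw [← ZMod.natCast_eq_natCast_iff]
    simpa using hd.symm
end

section
/- Let p be a prime with p ≡ 1 (mod 12) or p ≡ 7 (mod 12). Then for every integer k with 1 ≤ k ≤ p, the entry H(p,k) is divisible by 2. -/
/-- Entry of the determinant Hosoya triangle. -/
def detHosoya (r k : ℕ) : ℕ :=
  Nat.fib (k - 1) * Nat.fib (r - k + 2) + Nat.fib k * Nat.fib (r - k)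

theorem fib_mod_two (n : ℕ) : Nat.fib n % 2 = if n % 3 = 0 then 0 else 1 := by
  induction n using Nat.strong_induction_on with
  | _ n ih =>
    match n with
    | 0 => rfl
    | 1 => rfl
    | n + 2 =>
      have h₀ := ih n (by omega)
      have h₁ := ih (n + 1) (by omega)
      rw [Nat.fib_add_two]
      split_ifs at h₀ h₁ ⊢ <;> omega

theorem detHosoya_row_even (p : ℕ) (hp : p.Prime)
    (h12 : p % 12 = 1 ∨ p % 12 = 7) :
    ∀ k : ℕ, 1 ≤ k → k ≤ p → 2 ∣ detHosoya p k := by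
  intro k hk hkp
  have h₁ := fib_mod_two (k - 1)
  have h₂ := fib_mod_two (p - k + 2)
  have h₃ := fib_mod_two k
  have h₄ := fib_mod_two (p - k)
  rw [Nat.dvd_iff_mod_eq_zero, detHosoya, Nat.add_mod, Nat.mul_mod,
    Nat.mul_mod (Nat.fib k), h₁, h₂, h₃, h₄]
  split_ifs <;> omega
end
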